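/- (Lemma 2) Let e=(u,v) be an edge of a rooted tree instance and let f be a blocking flow in I(e) such that f(e) is the maximum element of Ψ(e). Then 𝒳 = {V_f(t) : t ∈ T_e ∪ {u}} is a cut-system of T_e ∪ {u} in I(e) satisfying 2α(f) = f(e) + Σ_{t∈T_e} f(e_t) = γ(𝒳) − κ(𝒳); consequently f is a maximum integral multiflow in I(e). -/

import Mathlib

open Classical

/-- `⟨a,b⟩`: the set `{a, a+2, …, b}` of consecutive odd or even integers. -/
def Iv (a b : ℕ) : Set ℕ := {x | a ≤ x ∧ x ≤ b ∧ x % 2 = a % 2}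

/-- `A ⊗ B = {a + b − 2i : a ∈ A, b ∈ B, 0 ≤ i ≤ min(a,b)}`. -/
def otimes (A B : Set ℕ) : Set ℕ :=
  {x | ∃ a ∈ A, ∃ b ∈ B, ∃ i, i ≤ min a b ∧ x = a + b - 2 * i}

/-- A tree instance `(G,T,c)` rooted at a terminal `r`: a tree on vertex set `V`,
encoded by the parent function `par` (with `par root = root`) together with a depth
function certifying acyclicity.  Each non-root vertex `v` is identified with the edge
`(par v, v)`; `c v` is the (positive integer) capacity of that edge.  The terminals are
the leaves; the root has exactly one child and every internal vertex has exactly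
two children (total degree 3). -/
structure RTI (V : Type*) where
  root : V
  par : V → V
  dep : V → ℕ
  c : V → ℕ
  par_root : par root = root
  dep_root : dep root = 0
  dep_par : ∀ v, v ≠ root → dep v = dep (par v) + 1
  cap_pos : ∀ v, v ≠ root → 1 ≤ c v
  root_degree : {w : V | par w = root ∧ w ≠ root}.ncard = 1
  internal_degree : ∀ v, v ≠ root → {w : V | par w = v ∧ w ≠ root}.Nonempty →
    {w : V | par w = v ∧ w ≠ root}.ncard = 2

namespace RTI

variable {V : Type*} (R : RTI V)

/-- `R.below u v`: `v` lies in the subtree rooted at `u` (i.e. `u` is an ancestor of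
`v`, allowing `u = v`). -/
def below (u v : V) : Prop :=
  Relation.ReflTransGen (fun a b => R.par b = a ∧ b ≠ R.root) u v

/-- `v` is a leaf of the tree other than the root. -/
def leaf (v : V) : Prop := v ≠ R.root ∧ ∀ w, w ≠ R.root → R.par w ≠ v

/-- The children of `v` (as lower endpoints of child-edges). -/
def children (v : V) : Set V := {w | R.par w = v ∧ w ≠ R.root}

/-- For an edge `e = (par v, v)`, the vertex set `V_e` of the instance `I(e)`. -/
def Ve (v : V) : Set V := insert (R.par v) {w | R.below v w}

/-- `T_e`: the terminals of `I(e)` other than `u = par v`. -/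
def Te (v : V) : Set V := {w | R.below v w ∧ R.leaf w}

/-- The full terminal set `T_e ∪ {u}` of the instance `I(e)`. -/
def S (v : V) : Set V := insert (R.par v) (R.Te v)

/-- The edge `(par x, x)` lies on the tree path between `t` and `t'`
(exactly one of `t, t'` is in the subtree below `x`). -/
def onPath (x t t' : V) : Prop :=
  (R.below x t ∧ ¬ R.below x t') ∨ (¬ R.below x t ∧ R.below x t')

/-- The vertex `x` lies on the tree path between `t` and `t'`. -/
def onPathV (x t t' : V) : Prop :=
  (R.below x t ∨ R.below x t') ∧ ∀ z, R.below z t → R.below z t' → R.below z x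

/-- Unordered pairs of distinct terminals of the instance `I(e)` for `e = (par v, v)`. -/
def PathPairs (v : V) : Set (Sym2 V) :=
  {p | ∃ t t', t ∈ R.S v ∧ t' ∈ R.S v ∧ t ≠ t' ∧ p = s(t, t')}

/-- `g` is a decomposition of `f` in the instance `I(e)`, `e = (par v, v)`:
`g` is supported on pairs of distinct terminals and, on every edge of `I(e)`,
`f` is the sum of `g` over the (unique) terminal-pair paths through that edge. -/
def IsDecomp (v : V) (f : V → ℕ) (g : Sym2 V → ℕ) : Prop :=
  (∀ p, g p ≠ 0 → p ∈ R.PathPairs v) ∧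
  ∀ w, R.below v w →
    f w = ∑ᶠ p ∈ {p : Sym2 V | ∃ t t', p = s(t, t') ∧ R.onPath w t t'}, g p

/-- `f` is an (integral) flow in the instance `I(e)`, `e = (par v, v)`. -/
def IsFlow (v : V) (f : V → ℕ) : Prop := ∃ g, R.IsDecomp v f g

/-- `f` is feasible in `I(e)`. -/
def Feasible (v : V) (f : V → ℕ) : Prop := ∀ w, R.below v w → f w ≤ R.c w

/-- `V_f(s)`: the set of vertices `w` of `I(e)` reachable from `s` by travelling
upward along edges with `c − f ≥ 1` to a common ancestor and then downward along
edges with `c − f ≥ 2`. -/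
def Vf (v : V) (f : V → ℕ) (s : V) : Set V :=
  {w | w ∈ R.Ve v ∧ ∃ z ∈ R.Ve v, R.below z s ∧ R.below z w ∧
    (∀ x, R.below z x → R.below x s → x ≠ z → f x + 1 ≤ R.c x) ∧
    (∀ x, R.below z x → R.below x w → x ≠ z → f x + 2 ≤ R.c x)}

/-- `W` induces a connected subgraph of the tree (it is closed under tree paths). -/
def ConnSet (W : Set V) : Prop :=
  ∀ w₁ ∈ W, ∀ w₂ ∈ W, ∀ x, R.onPathV x w₁ w₂ → x ∈ W

/-- `E(X)` inside the instance `I(e)`, `e = (par v, v)`: the edges `(par x, x)` of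
`I(e)` with exactly one endpoint in `X`. -/
def cutE (v : V) (X : Set V) : Set V :=
  {x | R.below v x ∧ ¬ (x ∈ X ↔ R.par x ∈ X)}

/-- `h(X) = Σ_{e' ∈ E(X)} h(e')` inside the instance `I(e)`, `e = (par v, v)`. -/
noncomputable def hval (v : V) (X : Set V) (h : V → ℕ) : ℕ := ∑ᶠ x ∈ R.cutE v X, h x

/-- `W` is a connected component of the subgraph of `I(e)` induced by `A`. -/
def IsComp (v : V) (A W : Set V) : Prop :=
  W.Nonempty ∧ W ⊆ A ∧ R.ConnSet W ∧
  (∀ x, R.below v x → x ∈ W → R.par x ∈ A → R.par x ∈ W) ∧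
  (∀ x, R.below v x → R.par x ∈ W → x ∈ A → x ∈ W)

/-- `odd(X)` (relative to the union `U` of the removed terminal sets): the components
`W` of `G_e − U` with `c(W)` odd whose parent-edge is a child-edge of `X`. -/
def oddOf (v : V) (U X : Set V) : Set (Set V) :=
  {W | R.IsComp v (R.Ve v \ U) W ∧ Odd (R.hval v W R.c) ∧
    ∃ y ∈ W, R.par y ∉ W ∧ R.par y ∈ X}

/-- The union of the sets `V_f(t)`, `t ∈ T_e`. -/
def UT (v : V) (f : V → ℕ) : Set V := ⋃ t ∈ R.Te v, R.Vf v f t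

/-- The union of the sets `V_f(t)`, `t ∈ T_e ∪ {u}`. -/
def USall (v : V) (f : V → ℕ) : Set V := ⋃ t ∈ R.S v, R.Vf v f t

/-- `f` is a blocking flow in `I(e)`, `e = (par v, v)`: a feasible flow such that
`{V_f(t) : t ∈ T_e}` is a cut-system of `T_e` (pairwise disjoint `t`-sets avoiding the
terminal `u = par v`) each member of which is blocked by `f`, i.e.
`f(e_t) = f(V_f(t)) = c(V_f(t)) − |odd(V_f(t))|`. -/
def IsBlocking (v : V) (f : V → ℕ) : Prop :=
  R.IsFlow v f ∧ R.Feasible v f ∧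
  (∀ t ∈ R.Te v, R.par v ∉ R.Vf v f t) ∧
  (∀ t ∈ R.Te v, ∀ t' ∈ R.Te v, t ≠ t' → R.Vf v f t ∩ R.Vf v f t' = ∅) ∧
  (∀ t ∈ R.Te v, f t = R.hval v (R.Vf v f t) f ∧
    R.hval v (R.Vf v f t) f + (R.oddOf v (R.UT v f) (R.Vf v f t)).ncard
      = R.hval v (R.Vf v f t) R.c)

/-- `Ψ(e)`: the set of values `f(e)` of blocking flows `f` of `I(e)`, `e = (par v, v)`. -/
def Psi (v : V) : Set ℕ := {x | ∃ f, R.IsBlocking v f ∧ f v = x}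

/-- `a(e)`: the least element of `Ψ(e)`. -/
noncomputable def aE (v : V) : ℕ := sInf (R.Psi v)

/-- `b(e)`: the greatest element of `Ψ(e)`. -/
noncomputable def bE (v : V) : ℕ := sSup (R.Psi v)

/-- The edge `(par x, x)` is dominating: `b(e') + 2 ≤ a(e)` for its sibling edge `e'`. -/
def Dominating (x : V) : Prop :=
  x ≠ R.root ∧ ∃ y, y ≠ R.root ∧ y ≠ x ∧ R.par y = R.par x ∧ R.bE y + 2 ≤ R.aE x

/-- The path from `v` down to `t` consists of dominating edges. -/
def DomPath (v t : V) : Prop :=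
  R.below v t ∧ ∀ x, R.below v x → R.below x t → x ≠ v → R.Dominating x

/-- Condition (a) for the edge `e = (par v, v)`. -/
def CondA (v : V) : Prop :=
  (∃ a b, R.Psi v = Iv a b) ∧
  (R.leaf v → R.Psi v = {R.c v}) ∧
  (∀ w₁ w₂, w₁ ≠ w₂ → R.children v = {w₁, w₂} →
    R.Psi v = (otimes (R.Psi w₁) (R.Psi w₂) ∩ Set.Iic (R.c v)) ∪ {R.c v})

/-- Condition (b) for the edge `e = (u,v)`: if `e` has a dominating child-edge
`e' = (v,w)`, then there is a terminal `t ∈ T_{e'}` with `g(u,t) ≥ a(e)` for every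
decomposition `g` of every blocking flow of `I(e)`, and `P_{v,t}` a dominating path. -/
def CondB (v : V) : Prop :=
  ∀ w ∈ R.children v, R.Dominating w →
    ∃ t ∈ R.Te w, R.DomPath v t ∧
      ∀ f g, R.IsBlocking v f → R.IsDecomp v f g → R.aE v ≤ g s(R.par v, t)

/-- `γ(𝒳)` for the cut-system `𝒳 = {V_f(t) : t ∈ T_e ∪ {u}}`. -/
noncomputable def gammaX (v : V) (f : V → ℕ) : ℕ :=
  ∑ᶠ t ∈ R.S v, R.hval v (R.Vf v f t) R.c

/-- `κ(𝒳)` for the cut-system `𝒳 = {V_f(t) : t ∈ T_e ∪ {u}}`: the number of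
components of `G_e − ∪𝒳` of odd capacity. -/
noncomputable def kappaX (v : V) (f : V → ℕ) : ℕ :=
  {W : Set V | R.IsComp v (R.Ve v \ R.USall v f) W ∧ Odd (R.hval v W R.c)}.ncard

end RTI

namespace RTI

section Ancestors

variable {V : Type*} {R : RTI V}

theorem below_refl (a : V) : R.below a a := Relation.ReflTransGen.refl

theorem below_trans {a b d : V} (h : R.below a b) (h' : R.below b d) : R.below a d :=
  Relation.ReflTransGen.trans h h'

theorem below_par {a : V} (h : a ≠ R.root) : R.below (R.par a) a :=
  Relation.ReflTransGen.single ⟨rfl, h⟩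

theorem below_iff {a b : V} :
    R.below a b ↔ a = b ∨ (b ≠ R.root ∧ R.below a (R.par b)) := by
  constructor
  · intro h
    rcases Relation.ReflTransGen.cases_tail h with h | ⟨d, h, rfl, hb⟩
    · exact Or.inl h.symm
    · exact Or.inr ⟨hb, h⟩
  · rintro (rfl | ⟨hb, h⟩)
    · exact below_refl a
    · exact below_trans h (below_par hb)

theorem below_par_of_ne {a b : V} (h : R.below a b) (hne : a ≠ b) : R.below a (R.par b) := by
  rcases below_iff.1 h with h | h
  · exact absurd h hne
  · exact h.2

theorem dep_le_of_below {a b : V} (h : R.below a b) : R.dep a ≤ R.dep b := by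
  induction h with
  | refl => exact le_rfl
  | tail _ hd ih =>
    have := R.dep_par _ hd.2
    rw [hd.1] at this
    omega

theorem below_antisymm {a b : V} (h : R.below a b) (h' : R.below b a) : a = b := by
  rcases below_iff.1 h with h1 | ⟨hb, h1⟩
  · exact h1
  · have h2 := dep_le_of_below h1
    have h3 := dep_le_of_below h'
    have h4 := R.dep_par _ hb
    omega

theorem below_total {a b d : V} (h : R.below a d) (h' : R.below b d) :
    R.below a b ∨ R.below b a := by
  induction h with
  | refl => exact Or.inr h'
  | tail hd hde ih =>
    obtain ⟨rfl, hr⟩ := hde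
    rcases below_iff.1 h' with rfl | ⟨-, h2⟩
    · exact Or.inl (below_trans hd (below_par hr))
    · exact ih h2

theorem not_below_root {a : V} (h : a ≠ R.root) : ¬ R.below a R.root := by
  intro h'
  rcases below_iff.1 h' with h1 | h1
  · exact h h1
  · exact h1.1 rfl

theorem ne_root_of_below {v x : V} (hv : v ≠ R.root) (h : R.below v x) : x ≠ R.root := by
  rintro rfl
  exact not_below_root hv h

theorem not_below_par {v : V} (hv : v ≠ R.root) : ¬ R.below v (R.par v) := by
  intro h
  have h1 := dep_le_of_below h
  have h2 := R.dep_par v hv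
  omega

theorem par_mem_Ve {v x : V} (h : R.below v x) : R.par x ∈ R.Ve v := by
  rcases below_iff.1 h with rfl | h
  · exact Or.inl rfl
  · exact Or.inr h.2

theorem par_below_of_mem_Ve {v x : V} (hv : v ≠ R.root) (h : x ∈ R.Ve v) :
    R.below (R.par v) x := by
  rcases h with rfl | h
  · exact below_refl _
  · exact below_trans (below_par hv) h

/-- A proper descendant of a vertex of `V_e` lies below `v`. -/
theorem below_of_mem_Ve {v z x : V} (hv : v ≠ R.root) (hz : z ∈ R.Ve v) (h : R.below z x)
    (hx : x ∈ R.Ve v) (hne : x ≠ z) : R.below v x := by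
  rcases hx with rfl | hx
  · exact absurd (below_antisymm (par_below_of_mem_Ve hv hz) h) hne
  · exact hx

theorem eq_of_leaf_below {t w : V} (ht : R.leaf t) (h : R.below t w) : t = w := by
  induction h with
  | refl => rfl
  | tail _ hd ih =>
    obtain ⟨rfl, hr⟩ := hd
    exact absurd ih.symm (ht.2 _ hr)

theorem par_not_mem_Te {v : V} (hv : v ≠ R.root) : R.par v ∉ R.Te v :=
  fun h => not_below_par hv h.1

theorem S_subset_Ve {v : V} : R.S v ⊆ R.Ve v := by
  rintro x (rfl | h)
  · exact Or.inl rfl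
  · exact Or.inr h.1

end Ancestors

section Residual

variable {V : Type*} {R : RTI V} {v : V} {f : V → ℕ}

theorem mem_Vf_self {s : V} (hs : s ∈ R.Ve v) : s ∈ R.Vf v f s := by
  refine ⟨hs, s, hs, below_refl s, below_refl s, ?_, ?_⟩ <;>
    exact fun x h h' hne => absurd (below_antisymm h' h) hne

theorem Vf_subset_Ve (s : V) : R.Vf v f s ⊆ R.Ve v := fun _ h => h.1

theorem mem_Ve_of_between {z x w : V} (hv : v ≠ R.root) (hz : z ∈ R.Ve v) (hzx : R.below z x)
    (hxw : R.below x w) (hw : w ∈ R.Ve v) : x ∈ R.Ve v := by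
  rcases hz with rfl | hz
  · rcases hw with rfl | hw
    · exact Or.inl (below_antisymm hxw hzx)
    · rcases below_total hw hxw with h | h
      · exact Or.inr h
      · rcases below_iff.1 h with rfl | h
        · exact Or.inr (below_refl _)
        · exact Or.inl (below_antisymm h.2 hzx)
  · exact Or.inr (below_trans hz hzx)

theorem connSet_Vf (hv : v ≠ R.root) {s : V} : R.ConnSet (R.Vf v f s) := by
  have key : ∀ w₂ z₁ z₂ x : V, w₂ ∈ R.Ve v →
      z₁ ∈ R.Ve v → R.below z₁ s → R.below z₁ z₂ → R.below z₂ s → R.below z₂ w₂ →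
      (∀ x, R.below z₁ x → R.below x s → x ≠ z₁ → f x + 1 ≤ R.c x) →
      (∀ x, R.below z₂ x → R.below x w₂ → x ≠ z₂ → f x + 2 ≤ R.c x) →
      R.below z₁ x → R.below x w₂ → x ∈ R.Vf v f s := by
    intro w₂ z₁ z₂ x hw₂ hz₁ hz₁s hz₁₂ hz₂s hz₂w₂ hup hdown hz₁x hxw₂
    have hx := mem_Ve_of_between hv hz₁ hz₁x hxw₂ hw₂
    rcases below_total hxw₂ hz₂w₂ with h | h
    · refine ⟨hx, x, hx, below_trans h hz₂s, below_refl x, ?_, ?_⟩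
      · intro y hy hys hne
        refine hup y (below_trans hz₁x hy) hys ?_
        rintro rfl
        exact hne (below_antisymm hz₁x hy)
      · exact fun y hy hy' hne => absurd (below_antisymm hy' hy) hne
    · refine ⟨hx, z₂, mem_Ve_of_between hv hz₁ hz₁₂ hz₂w₂ hw₂, hz₂s, h, ?_, ?_⟩
      · intro y hy hys hne
        refine hup y (below_trans hz₁₂ hy) hys ?_
        rintro rfl
        exact hne (below_antisymm hz₁₂ hy)
      · exact fun y hy hyx hne => hdown y hy (below_trans hyx hxw₂) hne
  intro w₁ h₁ w₂ h₂ x hx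
  obtain ⟨hw₁, z₁, hz₁, hz₁s, hz₁w, hup₁, hdown₁⟩ := h₁
  obtain ⟨hw₂, z₂, hz₂, hz₂s, hz₂w, hup₂, hdown₂⟩ := h₂
  rcases below_total hz₁s hz₂s with h | h
  · have hzx := hx.2 z₁ hz₁w (below_trans h hz₂w)
    rcases hx.1 with hx1 | hx1
    · exact key w₁ z₁ z₁ x hw₁ hz₁ hz₁s (below_refl _) hz₁s hz₁w hup₁ hdown₁ hzx hx1
    · exact key w₂ z₁ z₂ x hw₂ hz₁ hz₁s h hz₂s hz₂w hup₁ hdown₂ hzx hx1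
  · have hzx := hx.2 z₂ (below_trans h hz₁w) hz₂w
    rcases hx.1 with hx1 | hx1
    · exact key w₁ z₂ z₁ x hw₁ hz₂ hz₂s h hz₁s hz₁w hup₂ hdown₁ hzx hx1
    · exact key w₂ z₂ z₂ x hw₂ hz₂ hz₂s (below_refl _) hz₂s hz₂w hup₂ hdown₂ hzx hx1

/-- The set `V_f(u)` consists of the vertices reached from `u = par v` downwards along edges of
residual capacity at least two. -/
theorem mem_Vf_par_iff (hv : v ≠ R.root) {w : V} :
    w ∈ R.Vf v f (R.par v) ↔
      w ∈ R.Ve v ∧ ∀ x, R.below v x → R.below x w → f x + 2 ≤ R.c x := by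
  constructor
  · rintro ⟨hw, z, hz, hzs, hzw, -, hdown⟩
    obtain rfl := below_antisymm hzs (par_below_of_mem_Ve hv hz)
    refine ⟨hw, fun x hx hxw => hdown x (below_trans (below_par hv) hx) hxw ?_⟩
    rintro rfl
    exact not_below_par hv hx
  · rintro ⟨hw, h⟩
    have hu : R.par v ∈ R.Ve v := Or.inl rfl
    refine ⟨hw, R.par v, hu, below_refl _, par_below_of_mem_Ve hv hw, ?_, ?_⟩
    · exact fun x h h' hne => absurd (below_antisymm h' h) hne
    · intro x hx hxw hne
      exact h x (below_of_mem_Ve hv hu hx (mem_Ve_of_between hv hu hx hxw hw) hne) hxw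

/-- The edge entering `V_f(s)` from above is saturated. -/
theorem cap_le_of_enters_Vf {s x : V} (hv : v ≠ R.root) (hx : R.below v x)
    (hxs : x ∈ R.Vf v f s) (hpx : R.par x ∉ R.Vf v f s) : R.c x ≤ f x := by
  obtain ⟨hxV, z, hz, hzs, hzx, hup, hdown⟩ := hxs
  have hp := par_mem_Ve hx
  have hr := ne_root_of_below hv hx
  by_contra hlt
  apply hpx
  by_cases hne : z = x
  · subst hne
    refine ⟨hp, R.par z, hp, below_trans (below_par hr) hzs, below_refl _, ?_, ?_⟩
    · intro y hy hys hne
      rcases below_total hys hzs with h | h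
      · rcases below_iff.1 h with rfl | h
        · omega
        · exact absurd (below_antisymm h.2 hy) hne
      · by_cases hyz : y = z
        · subst hyz; omega
        · exact hup y h hys hyz
    · exact fun y h h' hne => absurd (below_antisymm h' h) hne
  · refine ⟨hp, z, hz, hzs, below_par_of_ne hzx hne, hup, ?_⟩
    exact fun y hy hyx hne => hdown y hy (below_trans hyx (below_par hr)) hne

/-- The edges leaving `V_f(s)` downwards have residual capacity at most one. -/
theorem cap_le_of_leaves_Vf {s x : V} (hv : v ≠ R.root) (hx : R.below v x)
    (hxs : x ∉ R.Vf v f s) (hpx : R.par x ∈ R.Vf v f s) : R.c x ≤ f x + 1 := by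
  obtain ⟨hxV, z, hz, hzs, hzx, hup, hdown⟩ := hpx
  have hr := ne_root_of_below hv hx
  by_contra hlt
  apply hxs
  refine ⟨Or.inr hx, z, hz, hzs, below_trans hzx (below_par hr), hup, ?_⟩
  intro y hy hyx hne
  rcases below_iff.1 hyx with rfl | h
  · omega
  · exact hdown y hy h.2 hne

/-- If `V_f(t)` avoids `u = par v`, then it is disjoint from `V_f(u)`. -/
theorem Vf_par_disjoint (hv : v ≠ R.root) {t : V} (ht : R.par v ∉ R.Vf v f t) :
    R.Vf v f (R.par v) ∩ R.Vf v f t = ∅ := by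
  rw [Set.eq_empty_iff_forall_notMem]
  rintro w ⟨hwu, hwt⟩
  obtain ⟨hw, h⟩ := (mem_Vf_par_iff hv).1 hwu
  obtain ⟨-, z, hz, hzt, hzw, hup, -⟩ := hwt
  have hu : R.par v ∈ R.Ve v := Or.inl rfl
  have huz := par_below_of_mem_Ve hv hz
  refine ht ⟨hu, R.par v, hu, below_trans huz hzt, below_refl _, ?_, ?_⟩
  · intro x hx hxt hne
    rcases below_total hxt hzt with hxz | hxz
    · have := h x (below_of_mem_Ve hv hu hx (mem_Ve_of_between hv hu hx hxz hz) hne)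
        (below_trans hxz hzw)
      omega
    · by_cases hxz' : x = z
      · subst hxz'
        have := h x (below_of_mem_Ve hv hu hx hz hne) hzw
        omega
      · exact hup x hxz hxt hxz'
  · exact fun x h h' hne => absurd (below_antisymm h' h) hne

/-- `V_f(t)` only depends on the values of `f` on edges with an endpoint in `V_f(t)`. -/
theorem Vf_congr (hv : v ≠ R.root) {f' : V → ℕ} {t : V} (htV : t ∈ R.Ve v)
    (hle : ∀ x, f x ≤ f' x)
    (heq : ∀ x, R.below v x → x ∈ R.Vf v f t → f' x = f x) :
    R.Vf v f' t = R.Vf v f t := by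
  ext w
  constructor
  · rintro ⟨hw, z, hz, hzt, hzw, hup, hdown⟩
    exact ⟨hw, z, hz, hzt, hzw, fun x h1 h2 h3 => le_trans (by simpa using hle x) (hup x h1 h2 h3),
      fun x h1 h2 h3 => le_trans (by simpa using hle x) (hdown x h1 h2 h3)⟩
  · rintro ⟨hw, z, hz, hzt, hzw, hup, hdown⟩
    refine ⟨hw, z, hz, hzt, hzw, fun x h1 h2 h3 => ?_, fun x h1 h2 h3 => ?_⟩
    · have hx := mem_Ve_of_between hv hz h1 h2 htV
      rw [heq x (below_of_mem_Ve hv hz h1 hx h3)]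
      · exact hup x h1 h2 h3
      · refine ⟨hx, x, hx, h2, below_refl _, fun y hy hyt hne => ?_, fun y h h' hne =>
          absurd (below_antisymm h' h) hne⟩
        refine hup y (below_trans h1 hy) hyt ?_
        rintro rfl
        exact hne (below_antisymm h1 hy)
    · have hx := mem_Ve_of_between hv hz h1 h2 hw
      rw [heq x (below_of_mem_Ve hv hz h1 hx h3)]
      · exact hdown x h1 h2 h3
      · exact ⟨hx, z, hz, hzt, h1, hup,
          fun y hy hyx hne => hdown y hy (below_trans hyx h2) hne⟩

end Residual

section Crossing

variable {V : Type*} {R : RTI V}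

/-- The edge `(par x, x)` lies on the path joining the two members of the pair `p`. -/
def Crosses (R : RTI V) (x : V) (p : Sym2 V) : Prop :=
  ∃ t t', p = s(t, t') ∧ R.onPath x t t'

theorem crosses_mk {x a b : V} : R.Crosses x s(a, b) ↔ R.onPath x a b := by
  constructor
  · rintro ⟨t, t', h, h'⟩
    rcases Sym2.eq_iff.1 h with ⟨rfl, rfl⟩ | ⟨rfl, rfl⟩
    · exact h'
    · unfold onPath at *
      tauto
  · exact fun h => ⟨a, b, rfl, h⟩

theorem finsum_mem_fintype {α : Type*} [Fintype α] (s : Set α) (h : α → ℕ) :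
    ∑ᶠ x ∈ s, h x = ∑ x, if x ∈ s then h x else 0 := by
  rw [finsum_mem_def, finsum_eq_sum_of_fintype]
  simp only [Set.indicator_apply]

variable {v : V}

/-- The lower endpoint of the edge incident to the terminal `s` of `I(e)`. -/
noncomputable def termEdge (R : RTI V) (v s : V) : V := if s = R.par v then v else s

theorem termEdge_par : R.termEdge v (R.par v) = v := if_pos rfl

theorem termEdge_of_mem_Te (hv : v ≠ R.root) {t : V} (ht : t ∈ R.Te v) :
    R.termEdge v t = t := by
  refine if_neg ?_
  rintro rfl
  exact par_not_mem_Te hv ht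

theorem below_termEdge (hv : v ≠ R.root) {s : V} (hs : s ∈ R.S v) :
    R.below v (R.termEdge v s) := by
  rcases hs with rfl | hs
  · rw [termEdge_par]; exact below_refl v
  · rw [termEdge_of_mem_Te hv hs]; exact hs.1

theorem onPath_termEdge_iff (hv : v ≠ R.root) {s t t' : V} (hs : s ∈ R.S v)
    (ht : t ∈ R.S v) (ht' : t' ∈ R.S v) (hne : t ≠ t') :
    R.onPath (R.termEdge v s) t t' ↔ s = t ∨ s = t' := by
  have key : ∀ a ∈ R.S v, R.below (R.termEdge v s) a ↔ ¬ (s = R.par v ↔ s = a) := by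
    rintro a ha
    rcases hs with rfl | hs
    · rw [termEdge_par]
      rcases ha with rfl | ha
      · simp [not_below_par hv]
      · have : R.par v ≠ a := by rintro rfl; exact par_not_mem_Te hv ha
        simp [this, ha.1]
    · rw [termEdge_of_mem_Te hv hs]
      have : s ≠ R.par v := by rintro rfl; exact par_not_mem_Te hv hs
      simp only [this, false_iff, not_not]
      exact ⟨eq_of_leaf_below hs.2, fun h => h ▸ below_refl _⟩
  unfold onPath
  rw [key t ht, key t' ht']
  by_cases h1 : s = t
  · subst h1; simp only [hne, true_or]; tauto
  · by_cases h2 : s = t'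
    · subst h2; simp only [h1, or_true]; tauto
    · simp [h1, h2]

variable [Fintype V] {f : V → ℕ} {g : Sym2 V → ℕ}

theorem hval_eq (X : Set V) (h : V → ℕ) :
    R.hval v X h = ∑ x, if x ∈ R.cutE v X then h x else 0 :=
  finsum_mem_fintype _ _

theorem hval_eq_sum_filter (X : Set V) (h : V → ℕ) :
    R.hval v X h = ∑ x with x ∈ R.cutE v X, h x := by
  rw [hval_eq, Finset.sum_filter]

theorem IsDecomp.apply (hg : R.IsDecomp v f g) {w : V} (hw : R.below v w) :
    f w = ∑ p, if R.Crosses w p then g p else 0 := by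
  rw [hg.2 w hw, finsum_mem_fintype]
  rfl

/-- The number of edges of `E(X)` crossed by the pair `p`. -/
noncomputable def cutCount (R : RTI V) (v : V) (X : Set V) (p : Sym2 V) : ℕ :=
  (Finset.univ.filter fun x => x ∈ R.cutE v X ∧ R.Crosses x p).card

theorem hval_flow (hg : R.IsDecomp v f g) (X : Set V) :
    R.hval v X f = ∑ p, g p * R.cutCount v X p := by
  rw [hval_eq]
  have : ∀ x, (if x ∈ R.cutE v X then f x else 0) =
      ∑ p, if x ∈ R.cutE v X ∧ R.Crosses x p then g p else 0 := by
    intro x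
    split_ifs with h
    · rw [hg.apply h.1]
      simp [h]
    · simp [h]
  simp_rw [this]
  rw [Finset.sum_comm]
  refine Finset.sum_congr rfl fun p _ => ?_
  rw [← Finset.sum_filter, Finset.sum_const, smul_eq_mul, mul_comm, cutCount]

theorem odd_card_cut_ancestors (hv : v ≠ R.root) (X : Set V) {w : V} (hw : w ∈ R.Ve v) :
    Odd (Finset.univ.filter fun x => x ∈ R.cutE v X ∧ R.below x w).card ↔
      ¬ (w ∈ X ↔ R.par v ∈ X) := by
  induction hn : R.dep w using Nat.strong_induction_on generalizing w with
  | _ n ih =>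
    rcases hw with rfl | hw
    · have : (Finset.univ.filter fun x => x ∈ R.cutE v X ∧ R.below x (R.par v)) = ∅ := by
        rw [Finset.filter_eq_empty_iff]
        rintro x - ⟨hx, hxv⟩
        exact not_below_par hv (below_trans hx.1 hxv)
      rw [this]
      simp
    · have hr := ne_root_of_below hv hw
      have hd := R.dep_par w hr
      have ih' := ih (R.dep (R.par w)) (by omega) (par_mem_Ve hw) rfl
      have hnb : ¬ R.below w (R.par w) := not_below_par hr
      by_cases hc : w ∈ R.cutE v X
      · have : (Finset.univ.filter fun x => x ∈ R.cutE v X ∧ R.below x w) =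
            insert w (Finset.univ.filter fun x => x ∈ R.cutE v X ∧ R.below x (R.par w)) := by
          ext x
          simp only [Finset.mem_filter, Finset.mem_univ, true_and, Finset.mem_insert]
          rw [below_iff (a := x) (b := w)]
          constructor
          · tauto
          · rintro (rfl | h)
            · exact ⟨hc, Or.inl rfl⟩
            · exact ⟨h.1, Or.inr ⟨hr, h.2⟩⟩
        rw [this, Finset.card_insert_of_notMem (by simp [hnb]), Nat.odd_add_one, ih']
        have := hc.2
        tauto
      · have : (Finset.univ.filter fun x => x ∈ R.cutE v X ∧ R.below x w) =
            (Finset.univ.filter fun x => x ∈ R.cutE v X ∧ R.below x (R.par w)) := by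
          ext x
          simp only [Finset.mem_filter, Finset.mem_univ, true_and]
          rw [below_iff (a := x) (b := w)]
          constructor
          · rintro ⟨h, rfl | h'⟩
            · exact absurd h hc
            · exact ⟨h, h'.2⟩
          · exact fun h => ⟨h.1, Or.inr ⟨hr, h.2⟩⟩
        rw [this, ih']
        have : w ∈ X ↔ R.par w ∈ X := by
          by_contra hne
          exact hc ⟨hw, hne⟩
        rw [this]

/-- A path crosses the boundary of `X` an odd number of times exactly when it has one end in
`X` and the other outside. -/
theorem odd_cutCount (hv : v ≠ R.root) (X : Set V) {a b : V} (ha : a ∈ R.Ve v)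
    (hb : b ∈ R.Ve v) : Odd (R.cutCount v X s(a, b)) ↔ ¬ (a ∈ X ↔ b ∈ X) := by
  have hA := odd_card_cut_ancestors hv X ha
  have hB := odd_card_cut_ancestors hv X hb
  have hsum : (Finset.univ.filter fun x => x ∈ R.cutE v X ∧ R.below x a).card +
      (Finset.univ.filter fun x => x ∈ R.cutE v X ∧ R.below x b).card =
      R.cutCount v X s(a, b) + 2 * (Finset.univ.filter fun x =>
        x ∈ R.cutE v X ∧ R.below x a ∧ R.below x b).card := by
    simp only [cutCount, Finset.card_filter, Finset.mul_sum, ← Finset.sum_add_distrib,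
      crosses_mk, onPath]
    refine Finset.sum_congr rfl fun x _ => ?_
    by_cases h1 : x ∈ R.cutE v X <;> by_cases h2 : R.below x a <;> by_cases h3 : R.below x b <;>
      simp [h1, h2, h3]
  rw [Nat.odd_iff] at *
  by_cases h1 : a ∈ X <;> by_cases h2 : b ∈ X <;> by_cases h3 : R.par v ∈ X <;>
    simp only [h1, h2, h3, iff_true, iff_false, not_true_eq_false, not_false_eq_true] at * <;>
    omega

/-- A set containing no terminal is crossed by a flow an even number of times. -/
theorem even_hval_flow (hv : v ≠ R.root) (hf : R.IsFlow v f) {W : Set V}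
    (hW : ∀ s ∈ R.S v, s ∉ W) : Even (R.hval v W f) := by
  obtain ⟨g, hg⟩ := hf
  rw [hval_flow hg]
  refine Finset.even_sum _ fun p _ => ?_
  by_cases hp : g p = 0
  · simp [hp]
  · obtain ⟨t, t', ht, ht', -, rfl⟩ := hg.1 p hp
    refine Even.mul_left ?_ _
    rw [← Nat.not_odd_iff_even, odd_cutCount hv W (S_subset_Ve ht) (S_subset_Ve ht')]
    simp [hW t ht, hW t' ht']

theorem flow_termEdge_le_hval (hv : v ≠ R.root) (hf : R.IsFlow v f) {s : V} (hs : s ∈ R.S v)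
    {X : Set V} (hX : X ∩ R.S v = {s}) : f (R.termEdge v s) ≤ R.hval v X f := by
  obtain ⟨g, hg⟩ := hf
  rw [hval_flow hg, hg.apply (below_termEdge hv hs)]
  refine Finset.sum_le_sum fun p _ => ?_
  split_ifs with hc
  · by_cases hp : g p = 0
    · simp [hp]
    · obtain ⟨t, t', ht, ht', hne, rfl⟩ := hg.1 p hp
      rw [crosses_mk, onPath_termEdge_iff hv hs ht ht' hne] at hc
      have hmem : ∀ a ∈ R.S v, a ∈ X ↔ a = s := fun a ha => by
        have : a ∈ X ∩ R.S v ↔ a = s := by rw [hX]; rfl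
        simpa [ha] using this
      have : Odd (R.cutCount v X s(t, t')) := by
        rw [odd_cutCount hv X (S_subset_Ve ht) (S_subset_Ve ht'), hmem t ht, hmem t' ht']
        rcases hc with rfl | rfl
        · simp [hne.symm]
        · simp [hne]
      exact Nat.le_mul_of_pos_right _ this.pos
  · exact Nat.zero_le _

/-- If strictly more flow crosses `V_f(u)` than starts at `u = par v`, some flow path joins two
terminals below `v` and meets `V_f(u)`. -/
theorem exists_pair_of_lt (hv : v ≠ R.root) (hg : R.IsDecomp v f g)
    (hlt : f v < R.hval v (R.Vf v f (R.par v)) f) :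
    ∃ t ∈ R.Te v, ∃ t' ∈ R.Te v, 0 < g s(t, t') ∧
      ∀ x, R.below v x → R.below x t → R.below x t' → x ∈ R.Vf v f (R.par v) := by
  rw [hval_flow hg, hg.apply (below_refl v)] at hlt
  obtain ⟨p, -, hp⟩ := Finset.exists_lt_of_sum_lt hlt
  have hgp : g p ≠ 0 := by
    intro h
    simp [h] at hp
  obtain ⟨t, t', ht, ht', hne, rfl⟩ := hg.1 p hgp
  -- along a path descending from `u` there is at most one crossing
  have hone : ∀ a ∈ R.Te v, R.cutCount v (R.Vf v f (R.par v)) s(R.par v, a) ≤ 1 := by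
    intro a ha
    rw [cutCount, Finset.card_le_one]
    have hlow : ∀ x ∈ R.cutE v (R.Vf v f (R.par v)),
        R.par x ∈ R.Vf v f (R.par v) ∧ x ∉ R.Vf v f (R.par v) := by
      rintro x ⟨hx, hxc⟩
      have : x ∈ R.Vf v f (R.par v) → R.par x ∈ R.Vf v f (R.par v) := by
        intro h
        rw [mem_Vf_par_iff hv] at h ⊢
        exact ⟨par_mem_Ve hx, fun y hy hyx =>
          h.2 y hy (below_trans hyx (below_par (ne_root_of_below hv hx)))⟩
      tauto
    have hba : ∀ x, x ∈ R.cutE v (R.Vf v f (R.par v)) →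
        R.Crosses x s(R.par v, a) → R.below x a := by
      intro x hx hxc
      rw [crosses_mk] at hxc
      rcases hxc with h | h
      · exact absurd (below_trans hx.1 h.1) (not_below_par hv)
      · exact h.2
    have hanti : ∀ x y, x ∈ R.cutE v (R.Vf v f (R.par v)) →
        y ∈ R.cutE v (R.Vf v f (R.par v)) → R.below x y → x = y := by
      intro x y hx hy hxy
      rcases below_iff.1 hxy with h | ⟨-, h⟩
      · exact h
      · exfalso
        apply (hlow x hx).2
        have := (mem_Vf_par_iff hv).1 (hlow y hy).1
        exact (mem_Vf_par_iff hv).2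
          ⟨Or.inr hx.1, fun z hz hzx => this.2 z hz (below_trans hzx h)⟩
    intro x hx y hy
    simp only [Finset.mem_filter, Finset.mem_univ, true_and] at hx hy
    rcases below_total (hba x hx.1 hx.2) (hba y hy.1 hy.2) with h | h
    · exact hanti x y hx.1 hy.1 h
    · exact (hanti y x hy.1 hx.1 h).symm
  have hcv : ∀ a ∈ R.Te v, R.Crosses v s(R.par v, a) := fun a ha =>
    crosses_mk.2 (Or.inr ⟨not_below_par hv, ha.1⟩)
  have hnotu : ∀ a ∈ R.Te v, ¬ ((if R.Crosses v s(R.par v, a) then g s(R.par v, a) else 0) <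
      g s(R.par v, a) * R.cutCount v (R.Vf v f (R.par v)) s(R.par v, a)) := by
    intro a ha h
    rw [if_pos (hcv a ha)] at h
    have := Nat.mul_le_mul_left (g s(R.par v, a)) (hone a ha)
    omega
  rcases ht with rfl | ht
  · rcases ht' with rfl | ht'
    · exact absurd rfl hne
    · exact absurd hp (hnotu t' ht')
  rcases ht' with rfl | ht'
  · rw [Sym2.eq_swap] at hp
    exact absurd hp (hnotu t ht)
  refine ⟨t, ht, t', ht', Nat.pos_of_ne_zero hgp, fun x hx hxt hxt' => ?_⟩
  have hpos : 0 < R.cutCount v (R.Vf v f (R.par v)) s(t, t') := by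
    by_contra h
    simp only [not_lt, Nat.le_zero] at h
    simp [h] at hp
  obtain ⟨y, hy⟩ := Finset.card_pos.1 hpos
  simp only [Finset.mem_filter, Finset.mem_univ, true_and, crosses_mk] at hy
  have hyu : y ∈ R.Vf v f (R.par v) ∨ R.par y ∈ R.Vf v f (R.par v) := by
    have := hy.1.2
    tauto
  have hxpy : R.below x (R.par y) := by
    have hxy : ∀ a b, R.below x a → R.below x b → R.below y a → ¬ R.below y b →
        R.below x (R.par y) := by
      intro a b ha hb hya hyb
      rcases below_total ha hya with h | h
      · refine below_par_of_ne h ?_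
        rintro rfl
        exact hyb hb
      · exact absurd (below_trans h hb) hyb
    rcases hy.2 with h | h
    · exact hxy t t' hxt hxt' h.1 h.2
    · exact hxy t' t hxt' hxt h.2 h.1
  have hdown : ∀ z, R.below x z → z ∈ R.Vf v f (R.par v) → x ∈ R.Vf v f (R.par v) := by
    intro z hxz hz
    have := (mem_Vf_par_iff hv).1 hz
    exact (mem_Vf_par_iff hv).2 ⟨Or.inr hx, fun w hw hwx => this.2 w hw (below_trans hwx hxz)⟩
  rcases hyu with h | h
  · exact hdown y (below_trans hxpy (below_par (ne_root_of_below hv hy.1.1))) h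
  · exact hdown _ hxpy h

/-- Rerouting one unit of flow between `t` and `t'` through `u = par v` yields a flow. -/
theorem isFlow_reroute (hv : v ≠ R.root) (hg : R.IsDecomp v f g) {t t' : V}
    (ht : t ∈ R.Te v) (ht' : t' ∈ R.Te v) (hpos : 0 < g s(t, t')) :
    R.IsFlow v fun x =>
      if R.below v x ∧ R.below x t ∧ R.below x t' then f x + 2 else f x := by
  obtain ⟨h, rfl⟩ : ∃ h : Sym2 V → ℕ, g = h + Pi.single s(t, t') 1 := by
    refine ⟨g - Pi.single s(t, t') 1, ?_⟩
    funext p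
    by_cases hp : p = s(t, t')
    · subst hp
      simp only [Pi.add_apply, Pi.sub_apply, Pi.single_eq_same]
      omega
    · simp [hp]
  have hpar : ∀ a ∈ R.Te v, R.par v ≠ a := by
    rintro a ha rfl
    exact par_not_mem_Te hv ha
  refine ⟨h + Pi.single s(R.par v, t) 1 + Pi.single s(R.par v, t') 1, ?_, ?_⟩
  · intro p hp
    by_cases h1 : p = s(R.par v, t)
    · exact ⟨R.par v, t, Or.inl rfl, Or.inr ht, hpar t ht, h1⟩
    by_cases h2 : p = s(R.par v, t')
    · exact ⟨R.par v, t', Or.inl rfl, Or.inr ht', hpar t' ht', h2⟩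
    refine hg.1 p ?_
    simp only [Pi.add_apply, Pi.single_apply, h1, h2, if_false, add_zero] at hp ⊢
    omega
  · intro w hw
    have hsingle : ∀ q : Sym2 V, (∑ p, if R.Crosses w p then
        (Pi.single q 1 : Sym2 V → ℕ) p else 0) = if R.Crosses w q then 1 else 0 := by
      intro q
      rw [Finset.sum_eq_single q]
      · simp
      · intro p _ hp
        simp [hp]
      · simp
    have hf := hg.apply hw
    rw [finsum_mem_fintype]
    change _ = ∑ p, if R.Crosses w p then _ else 0
    have hadd : ∀ a b : Sym2 V → ℕ, (∑ p, if R.Crosses w p then (a + b) p else 0) =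
        (∑ p, if R.Crosses w p then a p else 0) + ∑ p, if R.Crosses w p then b p else 0 := by
      intro a b
      rw [← Finset.sum_add_distrib]
      refine Finset.sum_congr rfl fun p _ => ?_
      split_ifs <;> simp
    rw [hadd, hsingle] at hf
    rw [hadd, hadd, hsingle, hsingle]
    have hwv : ¬ R.below w (R.par v) := fun h' => not_below_par hv (below_trans hw h')
    simp only [crosses_mk, onPath] at hf ⊢
    by_cases h1 : R.below w t <;> by_cases h2 : R.below w t' <;>
      simp only [h1, h2, hw, hwv, and_self, and_true, and_false, or_self, or_true, or_false,
        not_true_eq_false, not_false_eq_true, if_true, if_false] at hf ⊢ <;> omega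

/-- Among blocking flows, one with `f(e)` maximal has `f(V_f(u)) = f(e)`. -/
theorem hval_Vf_par_le_of_max (hv : v ≠ R.root) (hf : R.IsBlocking v f)
    (hmax : ∀ x ∈ R.Psi v, x ≤ f v) : R.hval v (R.Vf v f (R.par v)) f ≤ f v := by
  by_contra! hlt
  obtain ⟨⟨g, hg⟩, hfeas, havoid, hdisj, hblock⟩ := hf
  obtain ⟨t, ht, t', ht', hpos, hcommon⟩ := exists_pair_of_lt hv hg hlt
  have hflow := isFlow_reroute hv hg ht ht' hpos
  set f' : V → ℕ := fun x =>
    if R.below v x ∧ R.below x t ∧ R.below x t' then f x + 2 else f x with hf'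
  have hle : ∀ x, f x ≤ f' x := by
    intro x
    simp only [hf']
    split_ifs <;> omega
  have hin : ∀ x, f' x ≠ f x →
      x ∈ R.Vf v f (R.par v) ∧ R.par x ∈ R.Vf v f (R.par v) := by
    intro x hx
    have hcond : R.below v x ∧ R.below x t ∧ R.below x t' := by
      by_contra h
      exact hx (by simp only [hf', if_neg h])
    have hxu := hcommon x hcond.1 hcond.2.1 hcond.2.2
    refine ⟨hxu, ?_⟩
    rw [mem_Vf_par_iff hv] at hxu ⊢
    exact ⟨par_mem_Ve hcond.1, fun y hy hyx =>
      hxu.2 y hy (below_trans hyx (below_par (ne_root_of_below hv hcond.1)))⟩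
  have hnot : ∀ s ∈ R.Te v, ∀ x ∈ R.Vf v f s, x ∉ R.Vf v f (R.par v) := by
    intro s hs x hx hxu
    have := Vf_par_disjoint hv (havoid s hs)
    exact (Set.eq_empty_iff_forall_notMem.1 this) x ⟨hxu, hx⟩
  have hVf : ∀ s ∈ R.Te v, R.Vf v f' s = R.Vf v f s := by
    intro s hs
    refine Vf_congr hv (Or.inr hs.1) hle fun x _ hxs => ?_
    by_contra hne
    exact hnot s hs x hxs (hin x hne).1
  have hUT : R.UT v f' = R.UT v f := Set.iUnion₂_congr hVf
  have hhval : ∀ s ∈ R.Te v, R.hval v (R.Vf v f s) f' = R.hval v (R.Vf v f s) f := by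
    intro s hs
    refine finsum_mem_congr rfl fun x hx => ?_
    by_contra hne
    have h1 := hin x hne
    have h2 := hx.2
    have h3 := hnot s hs x
    have h4 := hnot s hs (R.par x)
    tauto
  have hblocking : R.IsBlocking v f' := by
    refine ⟨hflow, ?_, ?_, ?_, ?_⟩
    · intro w hw
      simp only [hf']
      split_ifs with h
      · exact ((mem_Vf_par_iff hv).1 (hcommon w h.1 h.2.1 h.2.2)).2 w hw (below_refl w)
      · exact hfeas w hw
    · intro s hs
      rw [hVf s hs]
      exact havoid s hs
    · intro s hs s' hs' hss
      rw [hVf s hs, hVf s' hs']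
      exact hdisj s hs s' hs' hss
    · intro s hs
      have hfs : f' s = f s := by
        by_contra hne
        exact hnot s hs s (mem_Vf_self (Or.inr hs.1)) (hin s hne).1
      rw [hVf s hs, hUT, hhval s hs, hfs]
      exact hblock s hs
  have h1 := hmax (f' v) ⟨f', hblocking, rfl⟩
  have h2 : f' v = f v + 2 := if_pos ⟨below_refl v, ht.1, ht'.1⟩
  omega

end Crossing

section Components

variable {V : Type*} {R : RTI V} {v : V} {A W W' : Set V}

theorem IsComp.subset_of_common (hv : v ≠ R.root) (hA : A ⊆ R.Ve v) (hW : R.IsComp v A W)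
    (hW' : R.IsComp v A W') {a : V} (ha : a ∈ W) (ha' : a ∈ W') : W ⊆ W' := by
  obtain ⟨-, hWA, hWc, -, -⟩ := hW
  obtain ⟨-, -, -, hup, hdown⟩ := hW'
  have descend : ∀ a ∈ W, a ∈ W' → ∀ w ∈ W, R.below a w → w ∈ W' := by
    intro a ha ha' w hw haw
    have hbetween : ∀ x, R.below a x → R.below x w → x ∈ W := fun x hax hxw =>
      hWc a ha w hw x ⟨Or.inr hxw, fun z hz _ => below_trans hz hax⟩
    have : ∀ x, R.below a x → R.below x w → x ∈ W' := by
      intro x hax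
      induction hax with
      | refl => exact fun _ => ha'
      | @tail b d hab hbd ih =>
        intro hdw
        obtain ⟨rfl, hr⟩ := hbd
        have had : R.below a d := below_trans hab (below_par hr)
        have hdW := hWA (hbetween d had hdw)
        refine hdown d ?_ (ih (below_trans (below_par hr) hdw)) hdW
        refine below_of_mem_Ve hv (hA (hWA ha)) had (hA hdW) ?_
        rintro rfl
        exact not_below_par hr hab
    exact this w haw (below_refl w)
  intro w hw
  induction hn : R.dep a using Nat.strong_induction_on generalizing a with
  | _ n ih =>
    by_cases haw : R.below a w
    · exact descend a ha ha' w hw haw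
    · have haV := hA (hWA ha)
      have hva : R.below v a := by
        rcases haV with rfl | h
        · exact absurd (par_below_of_mem_Ve hv (hA (hWA hw))) haw
        · exact h
      have hr := ne_root_of_below hv hva
      have hpa : R.par a ∈ W := by
        refine hWc a ha w hw _ ⟨Or.inl (below_par hr), fun z hz hzw => ?_⟩
        refine below_par_of_ne hz ?_
        rintro rfl
        exact haw hzw
      have hd := R.dep_par a hr
      exact ih _ (by omega) hpa (hup a hva ha' (hWA hpa)) rfl

theorem IsComp.eq_of_common (hv : v ≠ R.root) (hA : A ⊆ R.Ve v) (hW : R.IsComp v A W)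
    (hW' : R.IsComp v A W') {a : V} (ha : a ∈ W) (ha' : a ∈ W') : W = W' :=
  (hW.subset_of_common hv hA hW' ha ha').antisymm (hW'.subset_of_common hv hA hW ha' ha)

/-- The vertices reached from `x` downwards without meeting `U`. -/
def descendAvoiding (R : RTI V) (U : Set V) (x : V) : Set V :=
  {w | R.below x w ∧ ∀ y, R.below x y → R.below y w → y ∉ U}

theorem isComp_descendAvoiding (hv : v ≠ R.root) {U : Set V} {x : V} (hx : R.below v x)
    (hxU : x ∉ U) (hpU : R.par x ∈ U) :
    R.IsComp v (R.Ve v \ U) (R.descendAvoiding U x) := by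
  refine ⟨⟨x, below_refl x, ?_⟩, ?_, ?_, ?_, ?_⟩
  · intro y hxy hyx
    rwa [below_antisymm hyx hxy]
  · exact fun w hw => ⟨Or.inr (below_trans hx hw.1), hw.2 w hw.1 (below_refl w)⟩
  · intro a ha b hb y hy
    have hxy := hy.2 x ha.1 hb.1
    refine ⟨hxy, fun z hxz hzy => ?_⟩
    rcases hy.1 with h | h
    · exact ha.2 z hxz (below_trans hzy h)
    · exact hb.2 z hxz (below_trans hzy h)
  · intro y hy hyW hpy
    have hr := ne_root_of_below hv hy
    refine ⟨below_par_of_ne hyW.1 ?_, fun z hxz hzy =>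
      hyW.2 z hxz (below_trans hzy (below_par hr))⟩
    rintro rfl
    exact hpy.2 hpU
  · intro y hy hpy hyA
    have hr := ne_root_of_below hv hy
    refine ⟨below_trans hpy.1 (below_par hr), fun z hxz hzy => ?_⟩
    rcases below_iff.1 hzy with rfl | h
    · exact hyA.2
    · exact hpy.2 z hxz h.2

theorem descendAvoiding_injective {U : Set V} {x x' : V} (hx : x ∉ U) (hx' : x' ∉ U)
    (h : R.descendAvoiding U x = R.descendAvoiding U x') : x = x' := by
  have hself : ∀ y, y ∉ U → y ∈ R.descendAvoiding U y := fun y hy =>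
    ⟨below_refl y, fun z hz hz' => by rwa [below_antisymm hz' hz]⟩
  have h1 := hself x hx
  have h2 := hself x' hx'
  rw [h] at h1
  rw [← h] at h2
  exact below_antisymm h2.1 h1.1

theorem mem_cutE_descendAvoiding (hv : v ≠ R.root) {U : Set V} {x y : V}
    (hy : y ∈ R.cutE v (R.descendAvoiding U x)) :
    y = x ∨ (y ∈ U ∧ R.par y ∉ U) := by
  obtain ⟨hvy, hcut⟩ := hy
  have hr := ne_root_of_below hv hvy
  by_cases hyW : y ∈ R.descendAvoiding U x
  · left
    by_contra hne
    have hp : R.par y ∉ R.descendAvoiding U x := by tauto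
    refine hp ⟨below_par_of_ne hyW.1 (Ne.symm hne), fun z hz hzy =>
      hyW.2 z hz (below_trans hzy (below_par hr))⟩
  · right
    have hp : R.par y ∈ R.descendAvoiding U x := by tauto
    refine ⟨?_, hp.2 _ hp.1 (below_refl _)⟩
    by_contra hyU
    refine hyW ⟨below_trans hp.1 (below_par hr), fun z hz hzy => ?_⟩
    rcases below_iff.1 hzy with rfl | h
    · exact hyU
    · exact hp.2 z hz h.2

theorem IsComp.mem_of_mem_cutE {U : Set V} (hW : R.IsComp v (R.Ve v \ U) W) {x : V}
    (hx : x ∈ R.cutE v W) :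
    (x ∈ W ∧ R.par x ∈ U ∧ x ∉ U) ∨ (R.par x ∈ W ∧ x ∈ U ∧ R.par x ∉ U) := by
  obtain ⟨-, hWA, -, hup, hdown⟩ := hW
  obtain ⟨hvx, hcut⟩ := hx
  by_cases hxW : x ∈ W
  · left
    refine ⟨hxW, ?_, (hWA hxW).2⟩
    by_contra hpU
    have := hup x hvx hxW ⟨par_mem_Ve hvx, hpU⟩
    tauto
  · right
    have hp : R.par x ∈ W := by tauto
    refine ⟨hp, ?_, (hWA hp).2⟩
    by_contra hxU
    exact hxW (hdown x hvx hp ⟨Or.inr hvx, hxU⟩)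

end Components

section Counting

variable {V : Type*} {R : RTI V} {v : V} {f f' : V → ℕ}

theorem S_subset_USall : R.S v ⊆ R.USall v f := fun _ hs =>
  Set.mem_iUnion₂.2 ⟨_, hs, mem_Vf_self (S_subset_Ve hs)⟩

variable [Fintype V]

/-- The pairs of a terminal `s` and an edge of `E(V_f(s))` not saturated by `f'`. -/
noncomputable def slackEdges (R : RTI V) (v : V) (f f' : V → ℕ) : Finset (V × V) :=
  Finset.univ.filter fun q => q.1 ∈ R.S v ∧ q.2 ∈ R.cutE v (R.Vf v f q.1) ∧ f' q.2 < R.c q.2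

theorem mem_slackEdges {q : V × V} : q ∈ R.slackEdges v f f' ↔
    q.1 ∈ R.S v ∧ q.2 ∈ R.cutE v (R.Vf v f q.1) ∧ f' q.2 < R.c q.2 := by
  simp [slackEdges]

theorem gammaX_eq (hfeas : R.Feasible v f') :
    R.gammaX v f = (∑ s with s ∈ R.S v, R.hval v (R.Vf v f s) f') +
      ∑ q ∈ R.slackEdges v f f', (R.c q.2 - f' q.2) := by
  have h2 : ∑ q ∈ R.slackEdges v f f', (R.c q.2 - f' q.2) =
      ∑ s with s ∈ R.S v, ∑ x with x ∈ R.cutE v (R.Vf v f s), (R.c x - f' x) := by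
    simp only [slackEdges, Finset.sum_filter, ← Finset.univ_product_univ, Finset.sum_product]
    refine Finset.sum_congr rfl fun s _ => ?_
    split_ifs with hs
    · refine Finset.sum_congr rfl fun x _ => ?_
      by_cases hx : x ∈ R.cutE v (R.Vf v f s) <;> by_cases hlt : f' x < R.c x <;>
        simp only [hs, hx, hlt, and_self, and_true, and_false, if_true, if_false]
      omega
    · refine Finset.sum_eq_zero fun x _ => if_neg fun h => hs h.1
  rw [h2, gammaX, finsum_mem_fintype, ← Finset.sum_filter, ← Finset.sum_add_distrib]
  refine Finset.sum_congr rfl fun s _ => ?_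
  rw [hval_eq_sum_filter, hval_eq_sum_filter, ← Finset.sum_add_distrib]
  refine Finset.sum_congr rfl fun x hx => ?_
  have := hfeas x (Finset.mem_filter.1 hx).2.1
  omega

theorem kappaX_le_card_slackEdges (hv : v ≠ R.root) (hflow : R.IsFlow v f')
    (hfeas : R.Feasible v f') : R.kappaX v f ≤ (R.slackEdges v f f').card := by
  have hex : ∀ W : Set V, R.IsComp v (R.Ve v \ R.USall v f) W ∧ Odd (R.hval v W R.c) →
      ∃ q ∈ R.slackEdges v f f', q.2 ∈ R.cutE v W := by
    rintro W ⟨hW, hodd⟩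
    have heven := even_hval_flow hv hflow (W := W)
      fun s hs hsW => (hW.2.1 hsW).2 (S_subset_USall hs)
    have hx : ∃ x ∈ R.cutE v W, f' x ≠ R.c x := by
      by_contra! h
      rw [show R.hval v W f' = R.hval v W R.c from finsum_mem_congr rfl h] at heven
      exact (Nat.not_even_iff_odd.2 hodd) heven
    obtain ⟨x, hx, hne⟩ := hx
    have hlt : f' x < R.c x := lt_of_le_of_ne (hfeas x hx.1) hne
    rcases hW.mem_of_mem_cutE hx with ⟨-, hU, hn⟩ | ⟨-, hU, hn⟩
    · obtain ⟨s, hs, hxs⟩ := Set.mem_iUnion₂.1 hU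
      have hn' : x ∉ R.Vf v f s := fun h => hn (Set.mem_iUnion₂.2 ⟨s, hs, h⟩)
      exact ⟨(s, x), mem_slackEdges.2 ⟨hs, ⟨hx.1, fun h => hn' (h.2 hxs)⟩, hlt⟩, hx⟩
    · obtain ⟨s, hs, hxs⟩ := Set.mem_iUnion₂.1 hU
      have hn' : R.par x ∉ R.Vf v f s := fun h => hn (Set.mem_iUnion₂.2 ⟨s, hs, h⟩)
      exact ⟨(s, x), mem_slackEdges.2 ⟨hs, ⟨hx.1, fun h => hn' (h.1 hxs)⟩, hlt⟩, hx⟩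
  have : Nonempty (V × V) := ⟨(v, v)⟩
  choose! φ hφ hcut using hex
  rw [kappaX, ← Set.ncard_coe_finset]
  refine Set.ncard_le_ncard_of_injOn φ (fun W hW => hφ W hW) ?_ (Set.toFinite _)
  intro W hW W' hW' heq
  have h1 := hW.1.mem_of_mem_cutE (hcut W hW)
  have h2 := hW'.1.mem_of_mem_cutE (hcut W' hW')
  rw [← heq] at h2
  rcases h1 with ⟨a, b, d⟩ | ⟨a, b, d⟩ <;> rcases h2 with ⟨a', b', d'⟩ | ⟨a', b', d'⟩
  · exact hW.1.eq_of_common hv Set.sdiff_subset hW'.1 a a'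
  · exact absurd b d'
  · exact absurd b' d
  · exact hW.1.eq_of_common hv Set.sdiff_subset hW'.1 a a'

/-- The edges leaving the sets `V_f(s)` that are not saturated by `f` lie above distinct
components of odd capacity. -/
theorem sum_slackEdges_le_kappaX (hv : v ≠ R.root) (hflow : R.IsFlow v f)
    (hfeas : R.Feasible v f)
    (hdisj : ∀ t ∈ R.S v, ∀ t' ∈ R.S v, t ≠ t' → R.Vf v f t ∩ R.Vf v f t' = ∅) :
    ∑ q ∈ R.slackEdges v f f, (R.c q.2 - f q.2) ≤ R.kappaX v f := by
  have hsat : ∀ x, R.below v x → x ∈ R.USall v f →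
      (∃ s ∈ R.S v, ¬ (x ∈ R.Vf v f s ↔ R.par x ∈ R.Vf v f s)) → R.c x ≤ f x := by
    rintro x hx hxU ⟨s, hs, hcut⟩
    by_cases hxs : x ∈ R.Vf v f s
    · exact cap_le_of_enters_Vf hv hx hxs (by tauto)
    · have hps : R.par x ∈ R.Vf v f s := by tauto
      obtain ⟨t, ht, hxt⟩ := Set.mem_iUnion₂.1 hxU
      refine cap_le_of_enters_Vf hv hx hxt fun hpt => ?_
      have hne : s ≠ t := by
        rintro rfl
        exact hxs hxt
      exact (Set.eq_empty_iff_forall_notMem.1 (hdisj s hs t ht hne)) _ ⟨hps, hpt⟩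
  have hfacts : ∀ q ∈ R.slackEdges v f f, R.below v q.2 ∧ q.2 ∉ R.USall v f ∧
      R.par q.2 ∈ R.Vf v f q.1 ∧ q.1 ∈ R.S v ∧ R.c q.2 = f q.2 + 1 := by
    intro q hq
    obtain ⟨hs, ⟨hb, hcut⟩, hlt⟩ := mem_slackEdges.1 hq
    have hU : q.2 ∉ R.USall v f := fun hU => by
      have := hsat q.2 hb hU ⟨q.1, hs, hcut⟩
      omega
    have hn : q.2 ∉ R.Vf v f q.1 := fun h => hU (Set.mem_iUnion₂.2 ⟨_, hs, h⟩)
    have hp : R.par q.2 ∈ R.Vf v f q.1 := by tauto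
    have := cap_le_of_leaves_Vf hv hb hn hp
    exact ⟨hb, hU, hp, hs, by omega⟩
  have hcard : ∑ q ∈ R.slackEdges v f f, (R.c q.2 - f q.2) = (R.slackEdges v f f).card := by
    rw [Finset.card_eq_sum_ones]
    refine Finset.sum_congr rfl fun q hq => ?_
    have := (hfacts q hq).2.2.2.2
    omega
  rw [hcard, kappaX, ← Set.ncard_coe_finset]
  refine Set.ncard_le_ncard_of_injOn (fun q => R.descendAvoiding (R.USall v f) q.2) ?_ ?_
    (Set.toFinite _)
  · intro q hq
    obtain ⟨hb, hU, hp, hs, hc⟩ := hfacts q hq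
    have hpU : R.par q.2 ∈ R.USall v f := Set.mem_iUnion₂.2 ⟨_, hs, hp⟩
    have hcomp := isComp_descendAvoiding hv hb hU hpU
    refine ⟨hcomp, ?_⟩
    have hself : q.2 ∈ R.descendAvoiding (R.USall v f) q.2 :=
      ⟨below_refl _, fun z hz hz' => by rwa [below_antisymm hz' hz]⟩
    have hpself : R.par q.2 ∉ R.descendAvoiding (R.USall v f) q.2 := fun h =>
      (hcomp.2.1 h).2 hpU
    have hmem : q.2 ∈ R.cutE v (R.descendAvoiding (R.USall v f) q.2) := ⟨hb, by tauto⟩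
    have heven := even_hval_flow hv hflow (W := R.descendAvoiding (R.USall v f) q.2)
      fun s hs hsW => (hcomp.2.1 hsW).2 (S_subset_USall hs)
    have : R.hval v (R.descendAvoiding (R.USall v f) q.2) R.c =
        R.hval v (R.descendAvoiding (R.USall v f) q.2) f + 1 := by
      rw [hval_eq_sum_filter, hval_eq_sum_filter]
      have hm : q.2 ∈ Finset.univ.filter
          (· ∈ R.cutE v (R.descendAvoiding (R.USall v f) q.2)) := by simpa using hmem
      rw [← Finset.add_sum_erase _ _ hm, ← Finset.add_sum_erase _ _ hm, hc]
      have : ∀ x ∈ (Finset.univ.filter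
          (· ∈ R.cutE v (R.descendAvoiding (R.USall v f) q.2))).erase q.2, R.c x = f x := by
        intro x hx
        rw [Finset.mem_erase, Finset.mem_filter] at hx
        rcases mem_cutE_descendAvoiding hv hx.2.2 with h | ⟨h, h'⟩
        · exact absurd h hx.1
        · refine le_antisymm (hsat x hx.2.2.1 h ?_) (hfeas x hx.2.2.1)
          obtain ⟨s, hs, hxs⟩ := Set.mem_iUnion₂.1 h
          exact ⟨s, hs, fun hiff => h' (Set.mem_iUnion₂.2 ⟨s, hs, hiff.1 hxs⟩)⟩
      rw [Finset.sum_congr rfl this]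
      ring
    rw [this]
    exact heven.add_one
  · intro q hq q' hq' heq
    obtain ⟨-, hU, hp, hs, -⟩ := hfacts q hq
    obtain ⟨-, hU', hp', hs', -⟩ := hfacts q' hq'
    have h2 : q.2 = q'.2 := descendAvoiding_injective hU hU' heq
    refine Prod.ext ?_ h2
    by_contra hne
    rw [← h2] at hp'
    exact (Set.eq_empty_iff_forall_notMem.1 (hdisj _ hs _ hs' hne)) _ ⟨hp, hp'⟩

theorem sum_termEdge (hv : v ≠ R.root) (h : V → ℕ) :
    ∑ s with s ∈ R.S v, h (R.termEdge v s) = h v + ∑ᶠ t ∈ R.Te v, h t := by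
  have : (Finset.univ.filter (· ∈ R.S v)) =
      insert (R.par v) (Finset.univ.filter (· ∈ R.Te v)) := by
    ext x
    simp [S]
  rw [this, Finset.sum_insert (by simp [par_not_mem_Te hv]), termEdge_par, finsum_mem_fintype,
    ← Finset.sum_filter]
  congr 1
  exact Finset.sum_congr rfl fun t ht => by
    rw [termEdge_of_mem_Te hv (Finset.mem_filter.1 ht).2]

/-- Weak duality between feasible flows and the cut-system `V_f`. -/
theorem flow_add_kappaX_le_gammaX (hv : v ≠ R.root)
    (hterm : ∀ s ∈ R.S v, R.Vf v f s ∩ R.S v = {s})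
    (hflow : R.IsFlow v f') (hfeas : R.Feasible v f') :
    f' v + (∑ᶠ t ∈ R.Te v, f' t) + R.kappaX v f ≤ R.gammaX v f := by
  rw [gammaX_eq hfeas, ← sum_termEdge hv]
  refine add_le_add (Finset.sum_le_sum fun s hs => ?_)
    ((kappaX_le_card_slackEdges hv hflow hfeas).trans ?_)
  · have hs := (Finset.mem_filter.1 hs).2
    exact flow_termEdge_le_hval hv hflow hs (hterm s hs)
  · rw [Finset.card_eq_sum_ones]
    refine Finset.sum_le_sum fun q hq => ?_
    have := (mem_slackEdges.1 hq).2.2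
    omega

end Counting

end RTI

/-- Lemma 2: let `e = (u,v)` and let `f` be a blocking flow in `I(e)` with
`f(e)` the maximum of `Ψ(e)`.  Then `𝒳 = {V_f(t) : t ∈ T_e ∪ {u}}` is a cut-system of
`T_e ∪ {u}` in `I(e)` with `2α(f) = f(e) + Σ_{t∈T_e} f(e_t) = γ(𝒳) − κ(𝒳)`;
consequently `f` is a maximum integral multiflow in `I(e)`. -/
theorem RTI.blocking_max_Psi_is_maximum {V : Type*} [Fintype V] [DecidableEq V]
    (R : RTI V) (v : V) (hv : v ≠ R.root)
    (f : V → ℕ) (hf : R.IsBlocking v f)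
    (hmem : f v ∈ R.Psi v) (hmax : ∀ x ∈ R.Psi v, x ≤ f v) :
    (∀ t ∈ R.S v, R.Vf v f t ⊆ R.Ve v ∧ R.ConnSet (R.Vf v f t) ∧
        R.Vf v f t ∩ R.S v = {t}) ∧
    (∀ t ∈ R.S v, ∀ t' ∈ R.S v, t ≠ t' → R.Vf v f t ∩ R.Vf v f t' = ∅) ∧
    f v + (∑ᶠ t ∈ R.Te v, f t) + R.kappaX v f = R.gammaX v f ∧
    (∀ f', R.IsFlow v f' → R.Feasible v f' →
      f' v + (∑ᶠ t ∈ R.Te v, f' t) ≤ f v + (∑ᶠ t ∈ R.Te v, f t)) := by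
  have hu : ∀ t ∈ R.Te v, R.Vf v f (R.par v) ∩ R.Vf v f t = ∅ := fun t ht =>
    RTI.Vf_par_disjoint hv (hf.2.2.1 t ht)
  have hdisj : ∀ t ∈ R.S v, ∀ t' ∈ R.S v, t ≠ t' → R.Vf v f t ∩ R.Vf v f t' = ∅ := by
    rintro t (rfl | ht) t' (rfl | ht') hne
    · exact absurd rfl hne
    · exact hu t' ht'
    · rw [Set.inter_comm]
      exact hu t ht
    · exact hf.2.2.2.1 t ht t' ht' hne
  have hself : ∀ t ∈ R.S v, t ∈ R.Vf v f t := fun t ht =>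
    RTI.mem_Vf_self (RTI.S_subset_Ve ht)
  have hterm : ∀ t ∈ R.S v, R.Vf v f t ∩ R.S v = {t} := by
    intro t ht
    refine Set.Subset.antisymm ?_ (Set.singleton_subset_iff.2 ⟨hself t ht, ht⟩)
    rintro x ⟨hxt, hx⟩
    by_contra hne
    exact (Set.eq_empty_iff_forall_notMem.1 (hdisj t ht x hx (Ne.symm hne))) x
      ⟨hxt, hself x hx⟩
  have hle : ∀ f', R.IsFlow v f' → R.Feasible v f' →
      f' v + (∑ᶠ t ∈ R.Te v, f' t) + R.kappaX v f ≤ R.gammaX v f := fun f' hflow hfeas =>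
    RTI.flow_add_kappaX_le_gammaX hv hterm hflow hfeas
  have heq : f v + (∑ᶠ t ∈ R.Te v, f t) + R.kappaX v f = R.gammaX v f := by
    refine le_antisymm (hle f hf.1 hf.2.1) ?_
    rw [RTI.gammaX_eq hf.2.1, ← RTI.sum_termEdge hv]
    refine add_le_add (Finset.sum_le_sum fun s hs => ?_)
      (RTI.sum_slackEdges_le_kappaX hv hf.1 hf.2.1 hdisj)
    rcases (Finset.mem_filter.1 hs).2 with rfl | hs
    · rw [RTI.termEdge_par]
      exact RTI.hval_Vf_par_le_of_max hv hf hmax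
    · rw [RTI.termEdge_of_mem_Te hv hs]
      exact (hf.2.2.2.2 s hs).1.ge
  refine ⟨fun t ht => ⟨RTI.Vf_subset_Ve t, RTI.connSet_Vf hv, hterm t ht⟩, hdisj, heq, ?_⟩
  intro f' hflow hfeas
  have := hle f' hflow hfeas
  omega
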